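/- Let α = (φ,σ) be a minimal action of the infinite dihedral group ℤ⋊ℤ₂ on a Cantor set X. Then α is topologically free: for every (n,i) ∈ ℤ⋊ℤ₂ with (n,i) ≠ (0,0), the set {x ∈ X : φⁿ(σ^i(x)) = x} has empty interior. -/

import Mathlib

/-- A point fixed by a nontrivial power of a permutation has finite orbit. -/
theorem Equiv.Perm.finite_range_zpow_apply {α : Type*} (P : Equiv.Perm α) {m : ℤ} (hm : m ≠ 0)
    {x : α} (hx : (P ^ m) x = x) : (Set.range fun n : ℤ => (P ^ n) x).Finite := by
  refine ((Set.finite_Ico (0 : ℤ) |m|).image fun n : ℤ => (P ^ n) x).subset ?_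
  rintro _ ⟨n, rfl⟩
  refine ⟨n % m, ⟨Int.emod_nonneg _ hm, Int.emod_lt_abs _ hm⟩, ?_⟩
  conv_rhs => rw [← Int.emod_add_mul_ediv n m]
  simp only [zpow_add, zpow_mul, Equiv.Perm.mul_apply]
  rw [Equiv.Perm.zpow_apply_eq_self_of_apply_eq_self hx]

/-- An involution that conjugates a permutation to its inverse does so for all its powers. -/
theorem Equiv.Perm.apply_zpow_of_conj_eq_inv {α : Type*} (P S : Equiv.Perm α)
    (hS : S * S = 1) (h : S * P * S = P⁻¹) (n : ℤ) (x : α) :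
    S ((P ^ n) x) = (P ^ (-n)) (S x) := by
  have hSinv : S⁻¹ = S := inv_eq_of_mul_eq_one_right hS
  have key : S * P ^ n * S⁻¹ = P ^ (-n) := by
    rw [← conj_zpow, hSinv, h, inv_zpow, zpow_neg]
  have key' : S * P ^ n = P ^ (-n) * S := by rw [← key, inv_mul_cancel_right]
  simpa only [Equiv.Perm.mul_apply] using DFunLike.congr_fun key' x

/-- Let `α = (φ, σ)` be a minimal action of the infinite dihedral group `ℤ ⋊ ℤ₂` on a Cantor
set `X`.  Then `α` is topologically free: for every `(n, i) ≠ (0, 0)` in `ℤ ⋊ ℤ₂`, the set of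
points fixed by `φⁿ ∘ σ^i` has empty interior. -/
theorem dihedral_minimal_topologically_free {X : Type*} [TopologicalSpace X] [CompactSpace X]
    [TopologicalSpace.MetrizableSpace X] [TotallyDisconnectedSpace X] [PerfectSpace X]
    [Nonempty X] (φ σ : X ≃ₜ X)
    (hσ : ∀ x, σ (σ x) = x) (hrel : ∀ x, σ (φ (σ x)) = φ.symm x)
    (hmin : ∀ x : X,
      Dense {y : X | ∃ (n : ℤ) (i : Bool), y = (φ.toEquiv ^ n) (cond i (σ x) x)}) :
    ∀ (n : ℤ) (i : Bool), ¬(n = 0 ∧ i = false) →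
      interior {x : X | (φ.toEquiv ^ n) (cond i (σ x) x) = x} = ∅ := by
  have comm : ∀ (n : ℤ) (x : X),
      σ ((φ.toEquiv ^ n) x) = (φ.toEquiv ^ (-n)) (σ x) :=
    Equiv.Perm.apply_zpow_of_conj_eq_inv φ.toEquiv σ.toEquiv
      (Equiv.ext hσ) (Equiv.ext hrel)
  have aperiodic : ∀ (m : ℤ) (x : X), (φ.toEquiv ^ m) x = x → m = 0 := by
    intro m x hx
    by_contra hm
    have hσx : (φ.toEquiv ^ m) (σ x) = σ x := by
      have h := comm (-m) x
      rw [neg_neg, zpow_neg, Equiv.Perm.inv_eq_iff_eq.mpr hx.symm] at h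
      exact h.symm
    have hfin : {y : X | ∃ (n : ℤ) (i : Bool),
        y = (φ.toEquiv ^ n) (cond i (σ x) x)}.Finite := by
      refine ((Equiv.Perm.finite_range_zpow_apply φ.toEquiv hm hx).union
        (Equiv.Perm.finite_range_zpow_apply φ.toEquiv hm hσx)).subset ?_
      rintro _ ⟨n, _ | _, rfl⟩
      · exact Or.inl ⟨n, rfl⟩
      · exact Or.inr ⟨n, rfl⟩
    have huniv := (hmin x).closure_eq
    rw [hfin.isClosed.closure_eq] at huniv
    exact infinite_of_mem_nhds x Filter.univ_mem (huniv ▸ hfin)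
  intro n i hni
  by_contra hne
  obtain ⟨x, hx⟩ := Set.nonempty_iff_ne_empty.mpr hne
  have hfix := interior_subset hx
  cases i with
  | false => exact hni ⟨aperiodic n x hfix, rfl⟩
  | true =>
    simp only [cond_true, Set.mem_ofPred_eq] at hfix
    have hσx : σ x = (φ.toEquiv ^ (-n)) x := by
      rw [zpow_neg, Equiv.Perm.eq_inv_iff_eq, hfix]
    have hopen : IsOpen (interior {x : X | (φ.toEquiv ^ n) (cond true (σ x) x) = x} \ {x}) :=
      isOpen_interior.sdiff isClosed_singleton
    have hnonempty :
        (interior {x : X | (φ.toEquiv ^ n) (cond true (σ x) x) = x} \ {x}).Nonempty :=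
      ((infinite_of_mem_nhds x (isOpen_interior.mem_nhds hx)).sdiff
        (Set.finite_singleton x)).nonempty
    obtain ⟨y, ⟨hy, hyx⟩, m, j, hyorb⟩ := (hmin x).inter_open_nonempty _ hopen hnonempty
    obtain ⟨k, rfl⟩ : ∃ k : ℤ, y = (φ.toEquiv ^ k) x := by
      cases j with
      | false => exact ⟨m, hyorb⟩
      | true =>
        refine ⟨m + -n, ?_⟩
        rw [hyorb, cond_true, hσx, zpow_add, Equiv.Perm.mul_apply]
    have hyfix := interior_subset hy
    simp only [cond_true, Set.mem_ofPred_eq] at hyfix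
    have hneg : (φ.toEquiv ^ (-k)) x = (φ.toEquiv ^ k) x := by
      rw [← hyfix, comm, hσx, ← Equiv.Perm.mul_apply, ← Equiv.Perm.mul_apply, ← zpow_add,
        ← zpow_add]
      congr 2
      ring
    have hperiod : (φ.toEquiv ^ (k + k)) x = x := by
      rw [zpow_add, Equiv.Perm.mul_apply, ← hneg, ← Equiv.Perm.mul_apply, ← zpow_add,
        add_neg_cancel, zpow_zero, Equiv.Perm.one_apply]
    have hk : k = 0 := by
      have := aperiodic _ _ hperiod
      omega
    subst hk
    exact hyx rfl
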